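/- Let g ≥ 3 and K ≥ 1 be integers, and let θ be a real number with (g−1)θ ∈ I_g, with centred base-g expansion (g−1)θ = Σ_{i≥1} ε_i g^{−i}. Suppose there are integers m and T with 1 ≤ m ≤ K and T ≥ 0 such that ε_m ≠ 0 and ε_{m+1} = ⋯ = ε_{m+T} = 0, and let r ∈ {0, …, g−2} satisfy Σ_{j=1}^{m} ε_j ≡ r (mod g−1). Then |(1/g) · Σ_{y=0}^{g−1} e( g^{m−1} (y − (g−1)/2) (θ − r/(g−1)) )| ≤ C · g^{−T} for an absolute constant C. -/

import Mathlib

set_option autoImplicit false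

noncomputable section

/-- `e(x) = exp(2πix)`. -/
def eC (x : ℝ) : ℂ := Complex.exp (2 * Real.pi * Complex.I * x)

/-- The digit set of the centred base-`g` expansion: `{-(g-1)/2,…,(g-1)/2}` for odd `g`
and `{-(g-2)/2,…,g/2}` for even `g`. -/
def Rg (g : ℕ) : Set ℤ :=
  if g % 2 = 1 then Set.Icc (-(((g : ℤ) - 1) / 2)) (((g : ℤ) - 1) / 2)
  else Set.Icc (-(((g : ℤ) - 2) / 2)) ((g : ℤ) / 2)

/-- The fundamental interval `I_g`: `(-1/2, 1/2]` for odd `g` and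
`(-(g-2)/(2(g-1)), g/(2(g-1))]` for even `g`. -/
def Ig (g : ℕ) : Set ℝ :=
  if g % 2 = 1 then Set.Ioc (-(1 / 2)) (1 / 2)
  else Set.Ioc (-(((g : ℝ) - 2) / (2 * ((g : ℝ) - 1)))) ((g : ℝ) / (2 * ((g : ℝ) - 1)))

theorem eC_add (x y : ℝ) : eC (x + y) = eC x * eC y := by
  simp only [eC, ← Complex.exp_add]
  congr 1
  push_cast
  ring

theorem eC_natCast_mul (n : ℕ) (x : ℝ) : eC (n * x) = eC x ^ n := by
  simp only [eC, ← Complex.exp_nat_mul]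
  congr 1
  push_cast
  ring

theorem eC_intCast (n : ℤ) : eC n = 1 := by
  rw [eC, Complex.exp_eq_one_iff]
  exact ⟨n, by push_cast; ring⟩

theorem eC_intCast_add (n : ℤ) (x : ℝ) : eC (n + x) = eC x := by
  rw [eC_add, eC_intCast, one_mul]

theorem eC_eq_exp_I_mul (x : ℝ) : eC x = Complex.exp (Complex.I * ↑(2 * Real.pi * x)) := by
  simp only [eC]
  congr 1
  push_cast
  ring

theorem norm_eC (x : ℝ) : ‖eC x‖ = 1 := by
  rw [eC_eq_exp_I_mul, mul_comm, Complex.norm_exp_ofReal_mul_I]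

theorem norm_eC_sub_one (x : ℝ) : ‖eC x - 1‖ = 2 * |Real.sin (Real.pi * x)| := by
  rw [eC_eq_exp_I_mul, Complex.norm_exp_I_mul_ofReal_sub_one, norm_mul, Real.norm_eq_abs,
    Real.norm_eq_abs, abs_two]
  congr 3
  ring

theorem norm_eC_sub_one_le (x : ℝ) : ‖eC x - 1‖ ≤ 2 * Real.pi * |x| := by
  have h : |Real.sin (Real.pi * x)| ≤ |Real.pi * x| := Real.abs_sin_le_abs
  rw [abs_mul, abs_of_pos Real.pi_pos] at h
  rw [norm_eC_sub_one]
  linarith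

theorem le_norm_eC_sub_one {x c : ℝ} (hc : 0 ≤ c) (h₁ : c ≤ |x|) (h₂ : |x| ≤ 1 - c) :
    4 * c ≤ ‖eC x - 1‖ := by
  have key : ∀ y : ℝ, 0 ≤ y → y ≤ 1 / 2 → 2 * y ≤ Real.sin (Real.pi * y) := by
    intro y hy hy'
    have h := Real.mul_le_sin (x := Real.pi * y) (by positivity)
      (by nlinarith [Real.pi_pos])
    have e : 2 / Real.pi * (Real.pi * y) = 2 * y := by
      field_simp
    linarith
  have habs : |Real.sin (Real.pi * x)| = |Real.sin (Real.pi * |x|)| := by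
    rcases abs_choice x with h | h <;> rw [h]
    rw [mul_neg, Real.sin_neg, abs_neg]
  rw [norm_eC_sub_one, habs]
  have hle := le_abs_self (Real.sin (Real.pi * |x|))
  rcases le_total |x| (1 / 2) with h | h
  · linarith [key |x| (abs_nonneg x) h]
  · have hk := key (1 - |x|) (by linarith) (by linarith)
    rw [mul_one_sub Real.pi, Real.sin_pi_sub] at hk
    linarith

theorem norm_pow_sub_one_le {z : ℂ} (hz : ‖z‖ = 1) (n : ℕ) : ‖z ^ n - 1‖ ≤ n * ‖z - 1‖ := by
  rw [← geom_sum_mul, norm_mul]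
  gcongr
  refine (norm_sum_le _ _).trans ?_
  simp [hz]

theorem abs_le_of_mem_Rg {g : ℕ} {a : ℤ} (h : a ∈ Rg g) : |(a : ℝ)| ≤ g / 2 := by
  have h' : -(g : ℤ) ≤ 2 * a ∧ 2 * a ≤ g := by
    unfold Rg at h
    split_ifs at h <;> rw [Set.mem_Icc] at h <;> omega
  have h₁ : -(g : ℝ) ≤ 2 * a := by exact_mod_cast h'.1
  have h₂ : 2 * (a : ℝ) ≤ g := by exact_mod_cast h'.2
  rw [abs_le]
  constructor <;> linarith

/-- A base-`g` expansion whose digits are at most `g / 2` in absolute value converges, and has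
absolute value at most `3 / 4`. -/
theorem summable_expansion_and_abs_le {g : ℕ} (hg : 3 ≤ g) {a : ℕ → ℤ}
    (ha : ∀ i, |(a i : ℝ)| ≤ g / 2) :
    Summable (fun i => (a i : ℝ) / (g : ℝ) ^ (i + 1)) ∧
      |∑' i, (a i : ℝ) / (g : ℝ) ^ (i + 1)| ≤ 3 / 4 := by
  have hg' : (3 : ℝ) ≤ g := by exact_mod_cast hg
  have hgeom := (hasSum_geometric_of_lt_one (r := (g : ℝ)⁻¹) (by positivity)
    (inv_lt_one_of_one_lt₀ (by linarith))).mul_left (1 / 2)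
  have hb : ∀ i, ‖(a i : ℝ) / (g : ℝ) ^ (i + 1)‖ ≤ 1 / 2 * (g : ℝ)⁻¹ ^ i := by
    intro i
    rw [norm_div, norm_pow, Real.norm_eq_abs, Real.norm_natCast]
    calc |(a i : ℝ)| / (g : ℝ) ^ (i + 1) ≤ (g / 2) / (g : ℝ) ^ (i + 1) := by gcongr; exact ha i
      _ = 1 / 2 * (g : ℝ)⁻¹ ^ i := by
        rw [inv_pow]
        field_simp
        ring
  refine ⟨Summable.of_norm_bounded hgeom.summable hb, ?_⟩
  refine (tsum_of_norm_bounded hgeom hb).trans ?_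
  have h3 : (g : ℝ)⁻¹ ≤ 1 / 3 := by
    rw [inv_le_comm₀ (by linarith) (by norm_num)]
    linarith
  have h4 : (1 - (g : ℝ)⁻¹)⁻¹ ≤ 3 / 2 := by
    rw [inv_le_comm₀ (by linarith) (by norm_num)]
    linarith
  linarith

/-- Integer part and tail of an expansion multiplied by `g ^ m`. -/
theorem exists_pow_mul_sum_eq {g : ℕ} (hg : g ≠ 0) (a : ℕ → ℤ) (m : ℕ) :
    ∃ P : ℤ, (g : ℝ) ^ m * ∑ i ∈ Finset.range m, (a i : ℝ) / (g : ℝ) ^ (i + 1) = P ∧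
      P ≡ ∑ i ∈ Finset.range m, a i [ZMOD ((g : ℤ) - 1)] := by
  have hg' : (g : ℝ) ≠ 0 := by exact_mod_cast hg
  induction m with
  | zero => exact ⟨0, by simp, by simp⟩
  | succ m ih =>
    obtain ⟨P, hP, hmod⟩ := ih
    refine ⟨g * P + a m, ?_, ?_⟩
    · rw [Finset.sum_range_succ]
      push_cast
      rw [← hP]
      field_simp
      ring
    · rw [Finset.sum_range_succ]
      refine Int.ModEq.add_right _ ?_
      have h1 : (g : ℤ) ≡ 1 [ZMOD ((g : ℤ) - 1)] := (Int.modEq_iff_dvd.2 ⟨-1, by ring⟩)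
      simpa using h1.mul hmod

/-- If the digits with index in `[m, m + T)` vanish, the tail of the expansion after `m` digits,
rescaled by `g ^ m`, has size `O(g ^ (-T))`. -/
theorem exists_tsum_expansion_eq {g : ℕ} (hg : 3 ≤ g) {a : ℕ → ℤ}
    (ha : ∀ i, |(a i : ℝ)| ≤ g / 2) {m T : ℕ} (hzero : ∀ j, m ≤ j → j < m + T → a j = 0) :
    ∃ δ : ℝ, |δ| ≤ 3 / 4 * ((g : ℝ) ^ T)⁻¹ ∧
      (g : ℝ) ^ m * ∑' i, (a i : ℝ) / (g : ℝ) ^ (i + 1) =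
        (g : ℝ) ^ m * ∑ i ∈ Finset.range m, (a i : ℝ) / (g : ℝ) ^ (i + 1) + δ := by
  have hg' : (g : ℝ) ≠ 0 := by
    have : g ≠ 0 := by omega
    exact_mod_cast this
  have hsum := (summable_expansion_and_abs_le hg ha).1
  have htail := (summable_expansion_and_abs_le hg (fun i => ha (i + (m + T)))).2
  refine ⟨((g : ℝ) ^ T)⁻¹ * ∑' i, (a (i + (m + T)) : ℝ) / (g : ℝ) ^ (i + 1), ?_, ?_⟩
  · rw [abs_mul, abs_of_nonneg (by positivity), mul_comm]
    gcongr
  · rw [← hsum.sum_add_tsum_nat_add (m + T), mul_add, Finset.sum_range_add]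
    have h0 : ∑ i ∈ Finset.range T, (a (m + i) : ℝ) / (g : ℝ) ^ (m + i + 1) = 0 := by
      refine Finset.sum_eq_zero fun i hi => ?_
      rw [hzero (m + i) (by omega) (by have := Finset.mem_range.1 hi; omega)]
      simp
    rw [h0, add_zero, ← tsum_mul_left, ← tsum_mul_left]
    congr 2
    ext i
    field_simp
    ring

theorem norm_geom_sum_le {g : ℕ} (hg : 2 ≤ g) {z : ℂ} (hz : ‖z‖ = 1) {b : ℝ}
    (hlow : 1 / (g : ℝ) ≤ ‖z ^ (g - 1) - 1‖) (hup : ‖z ^ g - 1‖ ≤ b / ((g : ℝ) - 1)) :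
    ‖∑ y ∈ Finset.range g, z ^ y‖ ≤ g * b := by
  have hg' : (2 : ℝ) ≤ g := by exact_mod_cast hg
  have h1 : (0 : ℝ) < (g : ℝ) - 1 := by linarith
  have hlow' := hlow.trans (norm_pow_sub_one_le hz (g - 1))
  rw [Nat.cast_sub (by omega), Nat.cast_one, div_le_iff₀ (by linarith)] at hlow'
  rw [← geom_sum_mul, norm_mul, le_div_iff₀ h1] at hup
  have hS := norm_nonneg (∑ y ∈ Finset.range g, z ^ y)
  calc _ ≤ ‖∑ y ∈ Finset.range g, z ^ y‖ * (((g : ℝ) - 1) * ‖z - 1‖ * g) :=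
        le_mul_of_one_le_right hS hlow'
    _ = g * (‖∑ y ∈ Finset.range g, z ^ y‖ * ‖z - 1‖ * ((g : ℝ) - 1)) := by ring
    _ ≤ g * b := by gcongr

theorem statement14 :
    ∃ C : ℝ, 0 < C ∧ ∀ g K : ℕ, 3 ≤ g → 1 ≤ K →
      ∀ θ : ℝ, ((g : ℝ) - 1) * θ ∈ Ig g →
      ∀ ε : ℕ → ℤ, (∀ i : ℕ, 1 ≤ i → ε i ∈ Rg g) →
        (((g : ℝ) - 1) * θ = ∑' i : ℕ, (ε (i + 1) : ℝ) / (g : ℝ) ^ (i + 1)) →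
      ∀ m T : ℕ, 1 ≤ m → m ≤ K → ε m ≠ 0 →
        (∀ j : ℕ, m + 1 ≤ j → j ≤ m + T → ε j = 0) →
      ∀ r : ℕ, r ≤ g - 2 →
        (∑ j ∈ Finset.Icc 1 m, ε j) ≡ (r : ℤ) [ZMOD ((g : ℤ) - 1)] →
        ‖(1 / (g : ℂ)) * ∑ y ∈ Finset.range g,
            eC ((g : ℝ) ^ (m - 1) * ((y : ℝ) - ((g : ℝ) - 1) / 2) *
              (θ - (r : ℝ) / ((g : ℝ) - 1)))‖ ≤ C * ((g : ℝ) ^ T)⁻¹ := by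
  refine ⟨3 / 2 * Real.pi, by positivity, ?_⟩
  intro g K hg _ θ _ ε hε hθ m T hm _ hεm hzero r _ hr
  obtain ⟨n, rfl⟩ : ∃ n, m = n + 1 := ⟨m - 1, by omega⟩
  have hg3 : (3 : ℝ) ≤ g := by exact_mod_cast hg
  have hg0 : (g : ℝ) ≠ 0 := by linarith
  have hg1 : (0 : ℝ) < (g : ℝ) - 1 := by linarith
  have ha : ∀ i, |((ε (i + 1) : ℤ) : ℝ)| ≤ g / 2 :=
    fun i => abs_le_of_mem_Rg (hε (i + 1) (by omega))
  obtain ⟨δ, hδ, hsplit⟩ := exists_tsum_expansion_eq hg ha (m := n + 1) (T := T)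
    (fun j h₁ h₂ => hzero (j + 1) (by omega) (by omega))
  obtain ⟨P, hP, -⟩ := exists_pow_mul_sum_eq (by omega : g ≠ 0) (fun i => ε (i + 1)) n
  obtain ⟨Q, hQ, hQmod⟩ := exists_pow_mul_sum_eq (by omega : g ≠ 0) (fun i => ε (i + 1)) (n + 1)
  have hQP : (Q : ℝ) = g * P + ε (n + 1) := by
    rw [← hP, ← hQ, Finset.sum_range_succ]
    field_simp
    ring
  rw [← hθ, hQ] at hsplit
  have hQr : (g : ℤ) ^ (n + 1) * r ≡ Q [ZMOD ((g : ℤ) - 1)] := by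
    have h1 : (g : ℤ) ≡ 1 [ZMOD ((g : ℤ) - 1)] := Int.modEq_iff_dvd.2 ⟨-1, by ring⟩
    have h2 := (h1.pow (n + 1)).mul_right (r : ℤ)
    rw [one_pow, one_mul] at h2
    refine h2.trans (hr.symm.trans ?_)
    rw [Finset.range_eq_Ico, Finset.sum_Ico_add' (fun i => ε i) 0 (n + 1) 1] at hQmod
    exact hQmod.symm
  obtain ⟨N, hN⟩ := hQr.dvd
  have hN' : (Q : ℝ) - (g : ℝ) ^ (n + 1) * r = ((g : ℝ) - 1) * N := by exact_mod_cast hN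
  set β : ℝ := (g : ℝ) ^ n * (θ - r / ((g : ℝ) - 1)) with hβ
  have hgβ : (g : ℝ) * β = N + δ / ((g : ℝ) - 1) := by
    rw [hβ]
    field_simp
    linear_combination hsplit + hN'
  have hg1β : ((g : ℝ) - 1) * β = ((P - (g : ℤ) ^ n * r : ℤ) : ℝ) + (ε (n + 1) + δ) / g := by
    rw [hβ]
    push_cast
    field_simp
    linear_combination hsplit + hQP
  have hδ' : |δ| ≤ 3 / 4 := by
    refine hδ.trans (mul_le_of_le_one_right (by norm_num) ?_)
    exact inv_le_one_of_one_le₀ (one_le_pow₀ (by linarith))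
  have hlow : 1 / (g : ℝ) ≤ ‖eC β ^ (g - 1) - 1‖ := by
    rw [← eC_natCast_mul, Nat.cast_sub (by omega), Nat.cast_one, hg1β, eC_intCast_add]
    have hε1 : (1 : ℝ) ≤ |((ε (n + 1) : ℤ) : ℝ)| := by
      exact_mod_cast Int.one_le_abs hεm
    have hsub := abs_sub_abs_le_abs_sub ((ε (n + 1) : ℤ) : ℝ) (-δ)
    rw [abs_neg, sub_neg_eq_add] at hsub
    have hadd := abs_add_le ((ε (n + 1) : ℤ) : ℝ) δ
    have habs : |((ε (n + 1) : ℝ) + δ) / g| = |(ε (n + 1) : ℝ) + δ| / g := by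
      rw [abs_div, Nat.abs_cast]
    have h := le_norm_eC_sub_one (x := ((ε (n + 1) : ℝ) + δ) / g) (c := 1 / 4 / g)
      (by positivity)
      (by rw [habs]; gcongr; linarith)
      (by
        rw [habs, div_le_iff₀ (by linarith), sub_mul, div_mul_cancel₀ _ hg0]
        linarith [ha n])
    calc 1 / (g : ℝ) = 4 * (1 / 4 / g) := by ring
      _ ≤ _ := h
  have hup : ‖eC β ^ g - 1‖ ≤ 3 / 2 * Real.pi * ((g : ℝ) ^ T)⁻¹ / ((g : ℝ) - 1) := by
    rw [← eC_natCast_mul, hgβ, eC_intCast_add]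
    refine (norm_eC_sub_one_le _).trans ?_
    rw [abs_div, abs_of_pos hg1, ← mul_div_assoc]
    refine div_le_div_of_nonneg_right ?_ hg1.le
    calc 2 * Real.pi * |δ| ≤ 2 * Real.pi * (3 / 4 * ((g : ℝ) ^ T)⁻¹) := by gcongr
      _ = _ := by ring
  have hterm : ∀ y : ℕ, eC ((g : ℝ) ^ (n + 1 - 1) * ((y : ℝ) - ((g : ℝ) - 1) / 2) *
      (θ - (r : ℝ) / ((g : ℝ) - 1))) = eC β ^ y * eC (-(((g : ℝ) - 1) / 2 * β)) := by
    intro y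
    rw [← eC_natCast_mul, ← eC_add, Nat.add_sub_cancel, hβ]
    congr 1
    ring
  simp only [hterm]
  rw [← Finset.sum_mul, norm_mul, norm_mul, norm_eC, mul_one, norm_div, norm_one,
    Complex.norm_natCast, one_div, inv_mul_le_iff₀ (by linarith)]
  exact norm_geom_sum_le (by omega) (norm_eC β) hlow hup
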